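/- Let S = ⋃_{i∈I} S_i be a well-connected polyhedral mapping, let b, b̄ ∈ dom S with b ≠ b̄, and let 0 = μ_0 < μ_1 < … < μ_N = 1 together with indices i_1,…,i_N ∈ I connect b with b̄. Then for every x ∈ S(b) there exist points x^k ∈ S(b̄ + μ_k(b − b̄)), k = 0,…,N−1, such that d(x, S(b̄))/d(b, b̄) ≤ max{clm S(b̄ + μ_k(b − b̄), x^k) : k = 0,…,N−1} ≤ max{Lipusc S(b̄ + μ_k(b − b̄)) : k = 0,…,N−1}. -/

import Mathlib

open scoped ENNReal
open Filter EMetric Set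

/-- Calmness modulus of a set-valued mapping `M` at `(ybar, xbar)`. -/
noncomputable def clmMod {Y X : Type*} [PseudoEMetricSpace Y] [PseudoEMetricSpace X]
    (M : Y → Set X) (ybar : Y) (xbar : X) : ℝ≥0∞ :=
  Filter.limsup
    (fun x => EMetric.infEdist x (M ybar) / EMetric.infEdist ybar {y | x ∈ M y}) (nhds xbar)

/-- Lipschitz upper semicontinuity modulus of `M` at `ybar`. -/
noncomputable def lipuscMod {Y X : Type*} [PseudoEMetricSpace Y] [PseudoEMetricSpace X]
    (M : Y → Set X) (ybar : Y) : ℝ≥0∞ :=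
  Filter.limsup
    (fun y => ⨆ x ∈ M y, EMetric.infEdist x (M ybar) / edist y ybar) (nhds ybar)

/-- A convex polyhedral subset: a finite intersection of closed half-spaces. -/
def IsPolyhedral {E : Type*} [NormedAddCommGroup E] [NormedSpace ℝ E] (C : Set E) : Prop :=
  ∃ (k : ℕ) (f : Fin k → E →L[ℝ] ℝ) (c : Fin k → ℝ), C = {x | ∀ i, f i x ≤ c i}

/-- `S = ⋃_{i ∈ I} S_i` is a well-connected polyhedral mapping. -/
structure IsWellConnectedPolyhedral {Y X I : Type*}
    [NormedAddCommGroup Y] [NormedSpace ℝ Y] [NormedAddCommGroup X] [NormedSpace ℝ X]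
    [Finite I] (S : Y → Set X) (Si : I → Y → Set X) : Prop where
  graph_nonempty : ∀ i, {p : Y × X | p.2 ∈ Si i p.1}.Nonempty
  graph_polyhedral : ∀ i, IsPolyhedral {p : Y × X | p.2 ∈ Si i p.1}
  union : ∀ b, S b = ⋃ i, Si i b
  dom_convex : Convex ℝ {b | (S b).Nonempty}
  restrict : ∀ i b, (Si i b).Nonempty → S b = Si i b

/-- The calmness modulus never exceeds the Lipschitz upper semicontinuity modulus. -/
theorem clmMod_le_lipuscMod {Y X : Type*} [PseudoEMetricSpace Y] [PseudoEMetricSpace X]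
    (M : Y → Set X) {ybar : Y} {xbar : X} (hx : xbar ∈ M ybar) :
    clmMod M ybar xbar ≤ lipuscMod M ybar := by
  refine le_of_forall_gt_imp_ge_of_dense fun L hL => ?_
  have hL0 : L ≠ 0 := (bot_le.trans_lt hL).ne'
  obtain ⟨ε, hε, hball⟩ := EMetric.mem_nhds_iff.1 (Filter.eventually_lt_of_limsup_lt hL)
  refine Filter.limsup_le_of_le (by isBoundedDefault) ?_
  have hnear : ∀ᶠ x in nhds xbar, edist x xbar < L * ε :=
    Metric.eball_mem_nhds xbar (pos_iff_ne_zero.2 (mul_ne_zero hL0 hε.ne'))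
  filter_upwards [hnear] with x hxlt
  rcases eq_or_ne L ⊤ with rfl | hLtop
  · exact le_top
  refine ENNReal.div_le_of_le_mul ?_
  rw [mul_comm, ← ENNReal.div_le_iff_le_mul (.inl hL0) (.inl hLtop)]
  refine le_iInf₂ fun y hy => ?_
  rw [ENNReal.div_le_iff_le_mul (.inl hL0) (.inl hLtop), mul_comm]
  by_cases hyε : edist y ybar < ε
  · have hsup := (le_iSup₂ (f := fun x (_ : x ∈ M y) =>
      Metric.infEDist x (M ybar) / edist y ybar) x hy).trans (le_of_lt (hball hyε))
    rw [edist_comm ybar y]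
    by_cases h0 : edist y ybar = 0
    · have : Metric.infEDist x (M ybar) = 0 := by
        by_contra hne
        simp [h0, ENNReal.div_zero hne, hLtop] at hsup
      exact this.le.trans bot_le
    · exact (ENNReal.div_le_iff_le_mul (.inl h0) (.inr hL0)).1 hsup
  · rw [not_lt, edist_comm] at hyε
    calc Metric.infEDist x (M ybar) ≤ edist x xbar := Metric.infEDist_le_edist_of_mem hx
      _ ≤ L * ε := hxlt.le
      _ ≤ L * edist ybar y := by gcongr

/-- If the segment from `(ȳ, x̄)` to `(y, x)` lies in the graph of `M` and `x̄` is a nearest point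
to `x` in `M ȳ`, then the calmness modulus at `(ȳ, x̄)` controls the distance of `x` to `x̄`. -/
theorem edist_le_clmMod_mul_of_segment {Y X : Type*}
    [NormedAddCommGroup Y] [NormedSpace ℝ Y] [NormedAddCommGroup X] [NormedSpace ℝ X]
    (M : Y → Set X) {ybar y : Y} {xbar x : X} (hy : y ≠ ybar)
    (hnearest : Metric.infEDist x (M ybar) = edist x xbar)
    (hseg : ∀ t ∈ Set.Ioc (0 : ℝ) 1,
      AffineMap.lineMap xbar x t ∈ M (AffineMap.lineMap ybar y t)) :
    edist x xbar ≤ clmMod M ybar xbar * edist y ybar := by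
  refine (ENNReal.div_le_iff_le_mul (.inl (by simpa using hy)) (.inl (edist_ne_top _ _))).1 ?_
  have htend : Tendsto (fun t : ℝ => AffineMap.lineMap xbar x t) (nhdsWithin 0 (Set.Ioi 0))
      (nhds xbar) := by
    have h : Continuous fun t : ℝ => AffineMap.lineMap xbar x t := AffineMap.lineMap_continuous
    simpa using (h.tendsto 0).mono_left nhdsWithin_le_nhds
  refine Filter.le_limsup_of_frequently_le (htend.frequently (Eventually.frequently ?_))
    (by isBoundedDefault)
  filter_upwards [Ioc_mem_nhdsGT (zero_lt_one' ℝ)] with t ht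
  have hx : ENNReal.ofReal t * edist x xbar ≤
      Metric.infEDist (AffineMap.lineMap xbar x t) (M ybar) := by
    have hsplit : edist x (AffineMap.lineMap xbar x t) + ENNReal.ofReal t * edist x xbar
        = edist x xbar := by
      rw [edist_dist, edist_dist, dist_right_lineMap, ← ENNReal.ofReal_mul ht.1.le,
        ← ENNReal.ofReal_add (by positivity) (mul_nonneg ht.1.le dist_nonneg),
        Real.norm_of_nonneg (sub_nonneg.2 ht.2), dist_comm xbar x]
      congr 1
      ring
    have htri : Metric.infEDist x (M ybar) ≤ edist x (AffineMap.lineMap xbar x t) +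
        Metric.infEDist (AffineMap.lineMap xbar x t) (M ybar) :=
      Metric.infEDist_le_edist_add_infEDist
    rw [hnearest, ← hsplit] at htri
    exact (ENNReal.add_le_add_iff_left (edist_ne_top _ _)).1 htri
  have hden : Metric.infEDist ybar {z | AffineMap.lineMap xbar x t ∈ M z} ≤
      ENNReal.ofReal t * edist y ybar := by
    have hmem : AffineMap.lineMap ybar y t ∈ {z | AffineMap.lineMap xbar x t ∈ M z} := hseg t ht
    refine (Metric.infEDist_le_edist_of_mem hmem).trans_eq ?_
    rw [edist_dist, edist_dist, dist_left_lineMap, ← ENNReal.ofReal_mul ht.1.le,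
      Real.norm_of_nonneg ht.1.le, dist_comm ybar y]
  calc edist x xbar / edist y ybar
      = ENNReal.ofReal t * edist x xbar / (ENNReal.ofReal t * edist y ybar) :=
        (ENNReal.mul_div_mul_left _ _ (by simpa using ht.1) ENNReal.ofReal_ne_top).symm
    _ ≤ _ := ENNReal.div_le_div hx hden

theorem IsPolyhedral.convex {E : Type*} [NormedAddCommGroup E] [NormedSpace ℝ E] {C : Set E}
    (hC : IsPolyhedral C) : Convex ℝ C := by
  obtain ⟨k, f, c, rfl⟩ := hC
  simp only [ofPred_forall]
  exact convex_iInter fun i => convex_halfSpace_le (f i).isLinear (c i)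

theorem IsPolyhedral.isClosed {E : Type*} [NormedAddCommGroup E] [NormedSpace ℝ E] {C : Set E}
    (hC : IsPolyhedral C) : IsClosed C := by
  obtain ⟨k, f, c, rfl⟩ := hC
  simp only [ofPred_forall]
  exact isClosed_iInter fun i => isClosed_le (f i).continuous continuous_const

/-- On a segment contained in the domain of one polyhedral piece, each point of the value at one
endpoint is within calmness modulus times length of a point of the value at the other endpoint. -/
theorem IsWellConnectedPolyhedral.exists_edist_le_clmMod_mul {Y X I : Type*}
    [NormedAddCommGroup Y] [NormedSpace ℝ Y]
    [NormedAddCommGroup X] [NormedSpace ℝ X] [FiniteDimensional ℝ X]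
    [Finite I] {S : Y → Set X} {Si : I → Y → Set X}
    (hS : IsWellConnectedPolyhedral S Si) {i : I} {y₀ y₁ : Y} (hne : y₁ ≠ y₀)
    (h₀ : (Si i y₀).Nonempty) (h₁ : (Si i y₁).Nonempty) {x : X} (hx : x ∈ S y₁) :
    ∃ x₀ ∈ S y₀, edist x x₀ ≤ clmMod S y₀ x₀ * edist y₁ y₀ := by
  have : ProperSpace X := FiniteDimensional.proper ℝ X
  have hclosed : IsClosed (S y₀) := by
    rw [hS.restrict i y₀ h₀]
    exact (hS.graph_polyhedral i).isClosed.preimage (Continuous.prodMk_right y₀)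
  have hne₀ : (S y₀).Nonempty := hS.restrict i y₀ h₀ ▸ h₀
  obtain ⟨x₀, hx₀, hdist⟩ := hclosed.exists_infDist_eq_dist hne₀ x
  refine ⟨x₀, hx₀, edist_le_clmMod_mul_of_segment S hne ?_ fun t ht => ?_⟩
  · rw [edist_dist, ← hdist, Metric.infDist,
      ENNReal.ofReal_toReal (Metric.infEDist_ne_top hne₀)]
  · rw [hS.restrict i y₀ h₀] at hx₀
    rw [hS.restrict i y₁ h₁] at hx
    have hmem : AffineMap.lineMap x₀ x t ∈ Si i (AffineMap.lineMap y₀ y₁ t) := by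
      have h := (hS.graph_polyhedral i).convex.lineMap_mem (x := (y₀, x₀)) (y := (y₁, x))
        hx₀ hx ⟨ht.1.le, ht.2⟩
      simpa [AffineMap.lineMap_apply] using h
    rw [hS.union]
    exact mem_iUnion_of_mem i hmem

/-- Let `S = ⋃_{i∈I} S_i` be a well-connected polyhedral mapping,
`b, b̄ ∈ dom S`, `b ≠ b̄`, and let a subdivision `0 = μ_0 < … < μ_N = 1` with indices
`i_1, …, i_N ∈ I` connect `b` with `b̄`. Then for every `x ∈ S(b)` there exist points
`x^k ∈ S(b̄ + μ_k(b − b̄))`, `k = 0, …, N−1`, such that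
`d(x, S(b̄))/d(b,b̄) ≤ max_k clm S(b̄ + μ_k(b−b̄), x^k) ≤ max_k Lipusc S(b̄ + μ_k(b−b̄))`. -/
theorem ratio_le_max_clm_of_connecting {Y X I : Type*}
    [NormedAddCommGroup Y] [NormedSpace ℝ Y] [FiniteDimensional ℝ Y]
    [NormedAddCommGroup X] [NormedSpace ℝ X] [FiniteDimensional ℝ X]
    [Finite I] (S : Y → Set X) (Si : I → Y → Set X)
    (hS : IsWellConnectedPolyhedral S Si)
    (b bbar : Y) (hb : (S b).Nonempty) (hbbar : (S bbar).Nonempty) (hne : b ≠ bbar)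
    (N : ℕ) (μ : ℕ → ℝ) (idx : ℕ → I)
    (hN : 0 < N) (hμ0 : μ 0 = 0) (hμN : μ N = 1) (hmono : ∀ k < N, μ k < μ (k + 1))
    (hconn : ∀ k, 1 ≤ k → k ≤ N → ∀ t ∈ Set.Icc (μ (k - 1)) (μ k),
      (Si (idx k) (bbar + t • (b - bbar))).Nonempty) :
    ∀ x ∈ S b, ∃ xs : ℕ → X,
      (∀ k < N, xs k ∈ S (bbar + μ k • (b - bbar))) ∧
      EMetric.infEdist x (S bbar) / edist b bbar ≤
        (⨆ k ∈ Finset.range N, clmMod S (bbar + μ k • (b - bbar)) (xs k)) ∧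
      (⨆ k ∈ Finset.range N, clmMod S (bbar + μ k • (b - bbar)) (xs k)) ≤
        ⨆ k ∈ Finset.range N, lipuscMod S (bbar + μ k • (b - bbar)) := by
  intro x hx
  have hchain : ∀ n ≤ N, ∀ x ∈ S (bbar + μ n • (b - bbar)), ∃ xs : ℕ → X,
      (∀ k < n, xs k ∈ S (bbar + μ k • (b - bbar))) ∧ 0 ≤ μ n ∧
      ∀ C : ℝ≥0∞, (∀ k < n, clmMod S (bbar + μ k • (b - bbar)) (xs k) ≤ C) →
        Metric.infEDist x (S bbar) ≤ C * (ENNReal.ofReal (μ n) * edist b bbar) := by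
    intro n
    induction n with
    | zero =>
      intro _ x hx
      rw [hμ0, zero_smul, add_zero] at hx
      exact ⟨fun _ => x, by simp, hμ0.ge, fun C _ => by simp [Metric.infEDist_zero_of_mem hx]⟩
    | succ n ih =>
      intro hn x hx
      have hlt : μ n < μ (n + 1) := hmono n hn
      have hpiece := hconn (n + 1) (by omega) hn
      rw [Nat.add_sub_cancel] at hpiece
      have hdist : edist (bbar + μ (n + 1) • (b - bbar)) (bbar + μ n • (b - bbar))
          = ENNReal.ofReal (μ (n + 1) - μ n) * edist b bbar := by
        rw [edist_add_left, edist_dist, edist_dist, dist_eq_norm, ← sub_smul, norm_smul,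
          ← dist_eq_norm b, Real.norm_of_nonneg (sub_pos.2 hlt).le,
          ENNReal.ofReal_mul (sub_pos.2 hlt).le]
      have hne' : bbar + μ (n + 1) • (b - bbar) ≠ bbar + μ n • (b - bbar) := by
        rw [← edist_pos, hdist]
        exact ENNReal.mul_pos (by simpa using hlt) (edist_pos.2 hne).ne'
      obtain ⟨x₀, hx₀, hle⟩ := hS.exists_edist_le_clmMod_mul hne'
        (hpiece _ ⟨le_rfl, hlt.le⟩) (hpiece _ ⟨hlt.le, le_rfl⟩) hx
      obtain ⟨xs, hxs, hμn, hC⟩ := ih (by omega) x₀ hx₀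
      have hupd : ∀ k < n, Function.update xs n x₀ k = xs k := fun k hk =>
        Function.update_of_ne hk.ne _ _
      refine ⟨Function.update xs n x₀, fun k hk => ?_, hμn.trans hlt.le, fun C hCk => ?_⟩
      · rcases Nat.lt_succ_iff_lt_or_eq.1 hk with hk | rfl
        · rw [hupd k hk]
          exact hxs k hk
        · simpa using hx₀
      · have hCn := hCk n n.lt_succ_self
        rw [Function.update_self] at hCn
        have hrest := hC C fun k hk => hupd k hk ▸ hCk k (hk.trans n.lt_succ_self)
        calc Metric.infEDist x (S bbar)
            ≤ edist x x₀ + Metric.infEDist x₀ (S bbar) := Metric.infEDist_le_edist_add_infEDist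
          _ ≤ C * (ENNReal.ofReal (μ (n + 1) - μ n) * edist b bbar)
              + C * (ENNReal.ofReal (μ n) * edist b bbar) := by
            rw [hdist] at hle
            gcongr
            exact hle.trans (by gcongr)
          _ = C * (ENNReal.ofReal (μ (n + 1)) * edist b bbar) := by
            rw [← mul_add, ← add_mul, ← ENNReal.ofReal_add (sub_pos.2 hlt).le hμn,
              sub_add_cancel]
  obtain ⟨xs, hxs, -, hC⟩ := hchain N le_rfl x (by simpa [hμN] using hx)
  refine ⟨xs, hxs, ENNReal.div_le_of_le_mul ?_, ?_⟩
  · have h := hC _ fun k hk => le_iSup₂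
      (f := fun k (_ : k ∈ Finset.range N) => clmMod S (bbar + μ k • (b - bbar)) (xs k)) k
      (Finset.mem_range.2 hk)
    rw [hμN, ENNReal.ofReal_one, one_mul] at h
    exact h
  · exact iSup₂_mono fun k hk => clmMod_le_lipuscMod S (hxs k (Finset.mem_range.1 hk))
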